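/- In SG_3, with a12 = σ1², a13 = σ2σ1²σ2⁻¹, a23 = σ2², b12 = σ1τ1, b13 = σ2σ1τ1σ2⁻¹, b23 = σ2τ2, the following eight identities hold: (1) a12·a13·a12⁻¹ = a23⁻¹·a13·a23; (2) a12·a23·a12⁻¹ = a23⁻¹·a13⁻¹·a23·a13·a23; (3) a12·b12 = b12·a12; (4) a13·b13 = b13·a13; (5) a23·b23 = b23·a23; (6) b12·(a13·a23)·b12⁻¹ = a13·a23; (7) a12·b13·a12⁻¹ = a23⁻¹·b13·a23; (8) a12·b23·a12⁻¹ = a23⁻¹·a13⁻¹·b23·a13·a23. -/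

import Mathlib

/-- Defining relations of the singular braid group `SG₃`, as elements of the free
group on four generators `0 ↦ σ₁`, `1 ↦ σ₂`, `2 ↦ τ₁`, `3 ↦ τ₂`. -/
def sg3Rels : Set (FreeGroup (Fin 4)) :=
  {FreeGroup.of 0 * FreeGroup.of 2 * (FreeGroup.of 2 * FreeGroup.of 0)⁻¹,
   FreeGroup.of 1 * FreeGroup.of 3 * (FreeGroup.of 3 * FreeGroup.of 1)⁻¹,
   FreeGroup.of 0 * FreeGroup.of 1 * FreeGroup.of 0 *
     (FreeGroup.of 1 * FreeGroup.of 0 * FreeGroup.of 1)⁻¹,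
   FreeGroup.of 0 * FreeGroup.of 1 * FreeGroup.of 2 *
     (FreeGroup.of 3 * FreeGroup.of 0 * FreeGroup.of 1)⁻¹,
   FreeGroup.of 1 * FreeGroup.of 0 * FreeGroup.of 3 *
     (FreeGroup.of 2 * FreeGroup.of 1 * FreeGroup.of 0)⁻¹}

/-- The singular braid group on 3 strands. -/
abbrev SG3 : Type := PresentedGroup sg3Rels

def σ1 : SG3 := PresentedGroup.of 0
def σ2 : SG3 := PresentedGroup.of 1
def τ1 : SG3 := PresentedGroup.of 2
def τ2 : SG3 := PresentedGroup.of 3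

def a12 : SG3 := σ1 ^ 2
def a13 : SG3 := σ2 * σ1 ^ 2 * σ2⁻¹
def a23 : SG3 := σ2 ^ 2
def b12 : SG3 := σ1 * τ1
def b13 : SG3 := σ2 * σ1 * τ1 * σ2⁻¹
def b23 : SG3 := σ2 * τ2

theorem sg3_rel_st : σ1 * τ1 = τ1 * σ1 :=
  mul_inv_eq_one.mp (PresentedGroup.one_of_mem (rels := sg3Rels) (by simp [sg3Rels]))

theorem sg3_rel_st2 : σ2 * τ2 = τ2 * σ2 :=
  mul_inv_eq_one.mp (PresentedGroup.one_of_mem (rels := sg3Rels) (by simp [sg3Rels]))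

theorem sg3_rel_braid : σ1 * σ2 * σ1 = σ2 * σ1 * σ2 :=
  mul_inv_eq_one.mp (PresentedGroup.one_of_mem (rels := sg3Rels) (by simp [sg3Rels]))

theorem sg3_rel_mix : σ1 * σ2 * τ1 = τ2 * σ1 * σ2 :=
  mul_inv_eq_one.mp (PresentedGroup.one_of_mem (rels := sg3Rels) (by simp [sg3Rels]))

theorem sg3_rel_mix2 : σ2 * σ1 * τ2 = τ1 * σ2 * σ1 :=
  mul_inv_eq_one.mp (PresentedGroup.one_of_mem (rels := sg3Rels) (by simp [sg3Rels]))

/-- Conjugation by `a` is conjugation by `(p * q)⁻¹`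
    exactly when `a * p * q` commutes with the result. -/
theorem sg3_conj {G : Type*} [Group G] {a p q x : G} :
    a * x * a⁻¹ = q⁻¹ * p⁻¹ * x * p * q ↔ Commute (a * p * q) (a * x * a⁻¹) := by
  have key : q⁻¹ * p⁻¹ * x * p * q
      = (a * p * q)⁻¹ * (a * x * a⁻¹) * (a * p * q) := by group
  rw [key, mul_assoc (a * p * q)⁻¹, eq_inv_mul_iff_mul_eq]
  rfl

/-- The full twist is the square of the half twist. -/
theorem sg3_delta : a12 * a13 * a23 = (σ1 * σ2 * σ1) * (σ1 * σ2 * σ1) := by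
  have h := sg3_rel_braid
  calc a12 * a13 * a23 = σ1 * (σ1 * σ2 * σ1) * σ1 * σ2 := by
        simp only [a12, a13, a23, pow_two]; group
    _ = (σ1 * σ2 * σ1) * (σ2 * σ1 * σ2) := by
        conv_lhs => rw [h]
        simp only [mul_assoc]
    _ = _ := by rw [← h]

theorem sg3_swap {G : Type*} [Group G] {d x y : G} (h : d * x = y * d) (k : d * y = x * d) :
    Commute (d * d) x := by
  show d * d * x = x * (d * d)
  rw [mul_assoc, h, ← mul_assoc, k, mul_assoc]

theorem sg3_ds1 : (σ1 * σ2 * σ1) * σ1 = σ2 * (σ1 * σ2 * σ1) := by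
  conv_lhs => rw [sg3_rel_braid]
  simp only [mul_assoc]

theorem sg3_ds2 : (σ1 * σ2 * σ1) * σ2 = σ1 * (σ1 * σ2 * σ1) := by
  conv_rhs => rw [sg3_rel_braid]
  simp only [mul_assoc]

theorem sg3_dt1 : (σ1 * σ2 * σ1) * τ1 = τ2 * (σ1 * σ2 * σ1) := by
  rw [mul_assoc, sg3_rel_st, ← mul_assoc, sg3_rel_mix]
  simp only [mul_assoc]

theorem sg3_dt2 : (σ1 * σ2 * σ1) * τ2 = τ1 * (σ1 * σ2 * σ1) := by
  rw [mul_assoc σ1, mul_assoc σ1, sg3_rel_mix2, ← mul_assoc, ← mul_assoc, sg3_rel_st]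
  simp only [mul_assoc]

/-- The defining relations of `SP₃` hold among `a₁₂, a₁₃, a₂₃, b₁₂, b₁₃, b₂₃` in `SG₃`. -/
theorem stmt3 :
    a12 * a13 * a12⁻¹ = a23⁻¹ * a13 * a23 ∧
    a12 * a23 * a12⁻¹ = a23⁻¹ * a13⁻¹ * a23 * a13 * a23 ∧
    a12 * b12 = b12 * a12 ∧
    a13 * b13 = b13 * a13 ∧
    a23 * b23 = b23 * a23 ∧
    b12 * (a13 * a23) * b12⁻¹ = a13 * a23 ∧
    a12 * b13 * a12⁻¹ = a23⁻¹ * b13 * a23 ∧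
    a12 * b23 * a12⁻¹ = a23⁻¹ * a13⁻¹ * b23 * a13 * a23 := by
  have c1 : Commute (a12 * a13 * a23) σ1 := by
    rw [sg3_delta]; exact sg3_swap sg3_ds1 sg3_ds2
  have c2 : Commute (a12 * a13 * a23) σ2 := by
    rw [sg3_delta]; exact sg3_swap sg3_ds2 sg3_ds1
  have e1 : Commute (a12 * a13 * a23) τ1 := by
    rw [sg3_delta]; exact sg3_swap sg3_dt1 sg3_dt2
  have e2 : Commute (a12 * a13 * a23) τ2 := by
    rw [sg3_delta]; exact sg3_swap sg3_dt2 sg3_dt1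
  have ca12 : Commute (a12 * a13 * a23) a12 := c1.pow_right 2
  have ca23 : Commute (a12 * a13 * a23) a23 := c2.pow_right 2
  have ca13 : Commute (a12 * a13 * a23) a13 :=
    (c2.mul_right (c1.pow_right 2)).mul_right c2.inv_right
  have cb12 : Commute (a12 * a13 * a23) b12 := c1.mul_right e1
  have cb23 : Commute (a12 * a13 * a23) b23 := c2.mul_right e2
  have cb13 : Commute (a12 * a13 * a23) b13 :=
    ((c2.mul_right c1).mul_right e1).mul_right c2.inv_right
  have conj : ∀ x, Commute (a12 * a13 * a23) x →
      a12 * x * a12⁻¹ = a23⁻¹ * a13⁻¹ * x * a13 * a23 := fun x h =>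
    sg3_conj.2 ((ca12.mul_right h).mul_right ca12.inv_right)
  have st : Commute σ1 τ1 := sg3_rel_st
  have st2 : Commute σ2 τ2 := sg3_rel_st2
  have h3 : Commute a12 b12 := ((Commute.refl σ1).mul_right st).pow_left 2
  have h4 : a13 * b13 = b13 * a13 := by
    have e : a13 * b13 = σ2 * (a12 * b12) * σ2⁻¹ := by
      simp only [a13, b13, a12, b12]; group
    rw [e, h3.eq]
    simp only [a13, b13, a12, b12]; group
  have h5 : Commute a23 b23 := ((Commute.refl σ2).mul_right st2).pow_left 2
  refine ⟨?_, conj _ ca23, h3, h4, h5, ?_, ?_, conj _ cb23⟩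
  · rw [conj _ ca13]; group
  · have e : a13 * a23 = a12⁻¹ * (a12 * a13 * a23) := by group
    have hc : Commute b12 (a13 * a23) := by
      rw [e]; exact h3.symm.inv_right.mul_right cb12.symm
    rw [hc.eq, mul_inv_cancel_right]
  · rw [conj _ cb13, mul_assoc (a23⁻¹ * a13⁻¹), ← h4]; group
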